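/- Let W be a doubling 2π-periodic weight function with doubling constant L ≥ 2. Then for all integers k, ℓ, m such that 0 < |k| ≤ m and ℓ ≥ 5·log₂ L: ∫_{(2k-1)π/(2m+1)}^{(2k+1)π/(2m+1)} F_m(θ)^ℓ W(θ)dθ ≤ (2/(3|k|))^ℓ · ∫_{-π/(2m+1)}^{π/(2m+1)} W(θ)dθ. -/

import Mathlib

open MeasureTheory Real Set

noncomputable section

/-- Variant of the Fejér kernel: `F_m(θ) = (sin((2m+1)θ/2)/((2m+1)sin(θ/2)))²` away from
multiples of `2π` (where `sin(θ/2) = 0`), and `1` at multiples of `2π`. -/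
def Fm (m : ℕ) (θ : ℝ) : ℝ :=
  if Real.sin (θ / 2) = 0 then 1
  else (Real.sin ((2 * m + 1) * θ / 2) / ((2 * m + 1) * Real.sin (θ / 2))) ^ 2

/-- A `2π`-periodic weight function. -/
def IsPeriodicWeight (W : ℝ → ℝ) : Prop :=
  Measurable W ∧ (∀ θ, 0 ≤ W θ) ∧ Function.Periodic W (2 * π) ∧
  IntervalIntegrable W volume (-π) π ∧ 0 < ∫ θ in (-π)..π, W θ

/-- `W` is doubling with doubling constant `L` (periodic setting). -/
def IsDoublingPeriodic (W : ℝ → ℝ) (L : ℝ) : Prop :=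
  ∀ δ : ℝ, 0 < δ → ∀ a : ℝ,
    (∫ θ in (a - 2*δ)..(a + 2*δ), W θ) ≤ L * ∫ θ in (a - δ)..(a + δ), W θ

theorem three_div_pi_mul_le_sin {x : ℝ} (hx0 : 0 ≤ x) (hx : x ≤ π / 6) :
    3 / π * x ≤ sin x := by
  have hpi := Real.pi_pos
  have hc := strictConcaveOn_sin_Icc.concaveOn.2
    (show (0 : ℝ) ∈ Icc 0 π from ⟨le_rfl, hpi.le⟩)
    (show π / 6 ∈ Icc 0 π from ⟨by positivity, by linarith⟩)
    (show 0 ≤ 1 - 6 / π * x by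
      have : 6 / π * x ≤ 6 / π * (π / 6) := by gcongr
      have h1 : 6 / π * (π / 6) = 1 := by field_simp
      linarith) (show 0 ≤ 6 / π * x by positivity) (by ring)
  simp only [smul_eq_mul, sin_zero, mul_zero, zero_add, sin_pi_div_six] at hc
  have h2 : 6 / π * x * (π / 6) = x := by field_simp
  rw [h2] at hc
  calc 3 / π * x = 6 / π * x * (1 / 2) := by ring
    _ ≤ sin x := hc

theorem le_mul_abs_sin_half {N : ℝ} {K : ℕ} {θ : ℝ} (hK : 1 ≤ K) (hN : 2 * (K : ℝ) + 1 ≤ N)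
    (h1 : (2 * (K : ℝ) - 1) * (π / N) ≤ |θ|) (h2 : |θ| ≤ π) :
    3 * (K : ℝ) / 2 ≤ N * |sin (θ / 2)| := by
  have hpi := Real.pi_pos
  have hK' : (1 : ℝ) ≤ K := by exact_mod_cast hK
  have hN0 : 0 < N := by linarith
  have habs : |θ / 2| = |θ| / 2 := by rw [abs_div, abs_two]
  rw [Real.abs_sin_eq_sin_abs_of_abs_le_pi (by rw [habs]; linarith), habs]
  rcases hK.eq_or_lt with rfl | hK2
  · have hle : π / N / 2 ≤ |θ| / 2 := by norm_num at h1; linarith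
    have hN3 : 3 ≤ N := by norm_num at hN; linarith
    have hs : π / N / 2 ≤ π / 6 := by
      have : π / N ≤ π / 3 := by gcongr
      linarith
    have hmono : sin (π / N / 2) ≤ sin (|θ| / 2) :=
      Real.sin_le_sin_of_le_of_le_pi_div_two
        (by have : 0 < π / N := by positivity
            linarith) (by linarith) hle
    have h3 := three_div_pi_mul_le_sin (x := π / N / 2) (by positivity) hs
    calc 3 * ((1 : ℕ) : ℝ) / 2 = N * (3 / π * (π / N / 2)) := by
          push_cast; field_simp
      _ ≤ N * sin (|θ| / 2) := by gcongr; linarith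
  · have hK2' : (2 : ℝ) ≤ K := by exact_mod_cast hK2
    have h3 := Real.mul_le_sin (x := |θ| / 2) (by positivity) (by linarith)
    calc 3 * (K : ℝ) / 2 ≤ 2 * K - 1 := by linarith
      _ = N * (2 / π * ((2 * (K : ℝ) - 1) * (π / N) / 2)) := by field_simp
      _ ≤ N * (2 / π * (|θ| / 2)) := by gcongr
      _ ≤ N * sin (|θ| / 2) := by gcongr

theorem Fm_nonneg (m : ℕ) (θ : ℝ) : 0 ≤ Fm m θ := by
  unfold Fm
  split_ifs <;> positivity

theorem Fm_le {m K : ℕ} {θ : ℝ} (hK : 1 ≤ K) (hKm : K ≤ m)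
    (h1 : (2 * (K : ℝ) - 1) * (π / (2 * m + 1)) ≤ |θ|) (h2 : |θ| ≤ π) :
    Fm m θ ≤ (2 / (3 * (K : ℝ))) ^ 2 := by
  have hK' : (1 : ℝ) ≤ K := by exact_mod_cast hK
  have hKm' : (K : ℝ) ≤ m := by exact_mod_cast hKm
  have hs := le_mul_abs_sin_half (N := 2 * m + 1) hK (by linarith) h1 h2
  have hne : sin (θ / 2) ≠ 0 := by
    intro h
    rw [h, abs_zero, mul_zero] at hs
    linarith
  rw [Fm, if_neg hne, ← sq_abs]
  gcongr
  rw [abs_div, abs_mul, abs_of_pos (by positivity : (0 : ℝ) < 2 * m + 1)]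
  calc |sin ((2 * m + 1) * θ / 2)| / ((2 * m + 1) * |sin (θ / 2)|)
      ≤ 1 / (3 * (K : ℝ) / 2) := by
        gcongr
        exact abs_sin_le_one _
    _ = 2 / (3 * (K : ℝ)) := by field_simp

theorem IsDoublingPeriodic.integral_two_pow_mul_le {W : ℝ → ℝ} {L : ℝ}
    (hd : IsDoublingPeriodic W L) (hL : 0 ≤ L) {δ : ℝ} (hδ : 0 < δ) (j : ℕ) :
    (∫ θ in (-(2 ^ j * δ))..(2 ^ j * δ), W θ) ≤ L ^ j * ∫ θ in (-δ)..δ, W θ := by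
  induction j with
  | zero => simp
  | succ j ih =>
    have h := hd (2 ^ j * δ) (by positivity) 0
    simp only [zero_sub, zero_add] at h
    rw [show (2 : ℝ) ^ (j + 1) * δ = 2 * (2 ^ j * δ) by ring]
    calc _ ≤ L * ∫ θ in (-(2 ^ j * δ))..(2 ^ j * δ), W θ := h
      _ ≤ L * (L ^ j * ∫ θ in (-δ)..δ, W θ) := by gcongr
      _ = _ := by ring

theorem IsPeriodicWeight.intervalIntegrable {W : ℝ → ℝ} (hW : IsPeriodicWeight W) (a b : ℝ) :
    IntervalIntegrable W volume a b := by
  obtain ⟨-, -, hper, hint, -⟩ := hW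
  refine hper.intervalIntegrable (t := -π) (by positivity) ?_ a b
  rwa [show -π + 2 * π = π by ring]

theorem pow_le_of_five_mul_logb_le {L : ℝ} (hL : 0 < L) {ℓ j K : ℕ}
    (hℓ : 5 * Real.logb 2 L ≤ (ℓ : ℝ)) (hK : 1 ≤ K) (hj : 2 ^ j ≤ 4 * K) :
    L ^ j ≤ (3 * (K : ℝ) / 2) ^ ℓ := by
  have hK' : (1 : ℝ) ≤ K := by exact_mod_cast hK
  have hj' : (2 : ℝ) ^ j ≤ 4 * K := by exact_mod_cast hj
  have hL5 : L ^ 5 ≤ 2 ^ ℓ := by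
    have h : Real.logb 2 (L ^ 5) ≤ ℓ := by
      rw [Real.logb_pow]
      exact_mod_cast hℓ
    rw [Real.logb_le_iff_le_rpow (by norm_num) (by positivity)] at h
    exact_mod_cast h
  have hK5 : 4 * (K : ℝ) ≤ (3 * (K : ℝ) / 2) ^ 5 := by
    have : (K : ℝ) ≤ K ^ 5 := le_self_pow₀ hK' (by norm_num)
    calc 4 * (K : ℝ) ≤ (3 / 2) ^ 5 * K ^ 5 := by norm_num; linarith
      _ = _ := by ring
  refine le_of_pow_le_pow_left₀ (n := 5) (by norm_num) (by positivity) ?_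
  calc (L ^ j) ^ 5 = (L ^ 5) ^ j := by ring
    _ ≤ (2 ^ ℓ) ^ j := by gcongr
    _ = (2 ^ j) ^ ℓ := by ring
    _ ≤ ((3 * (K : ℝ) / 2) ^ 5) ^ ℓ := by gcongr; exact hj'.trans hK5
    _ = _ := pow_right_comm _ _ _

theorem fejer_doubling_tail (W : ℝ → ℝ) (L : ℝ) (hL : 2 ≤ L)
    (hW : IsPeriodicWeight W) (hd : IsDoublingPeriodic W L)
    (k : ℤ) (m ℓ : ℕ) (hk : 0 < |k|) (hkm : |k| ≤ (m : ℤ))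
    (hℓ : 5 * Real.logb 2 L ≤ (ℓ : ℝ)) :
    (∫ θ in ((2*(k:ℝ)-1) * π / (2*m+1))..((2*(k:ℝ)+1) * π / (2*m+1)), (Fm m θ) ^ ℓ * W θ) ≤
      (2 / (3 * |(k:ℝ)|)) ^ ℓ * ∫ θ in (-(π / (2*m+1)))..(π / (2*m+1)), W θ := by
  have hpi := Real.pi_pos
  have hW0 : ∀ θ, 0 ≤ W θ := hW.2.1
  have hL0 : 0 < L := by linarith
  obtain ⟨K, hKk⟩ : ∃ K : ℕ, |k| = K := ⟨k.natAbs, (Int.natCast_natAbs k).symm⟩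
  have hK : 1 ≤ K := by omega
  have hKm : K ≤ m := by omega
  have hK' : (1 : ℝ) ≤ K := by exact_mod_cast hK
  have hKm' : (K : ℝ) ≤ m := by exact_mod_cast hKm
  have hKr : |(k : ℝ)| = K := by rw [← Int.cast_abs, hKk, Int.cast_natCast]
  rw [hKr]
  set δ : ℝ := π / (2 * m + 1) with hδ
  have hδ0 : 0 < δ := by positivity
  have hδm : (2 * (m : ℝ) + 1) * δ = π := by rw [hδ]; field_simp
  rw [mul_div_assoc, mul_div_assoc, ← hδ]
  have hab : (2 * (k : ℝ) - 1) * δ ≤ (2 * (k : ℝ) + 1) * δ := by gcongr; linarith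
  have hrange : ∀ θ ∈ Ioc ((2 * (k : ℝ) - 1) * δ) ((2 * (k : ℝ) + 1) * δ),
      (2 * (K : ℝ) - 1) * δ ≤ |θ| ∧ |θ| ≤ (2 * (K : ℝ) + 1) * δ := by
    rintro θ ⟨h1, h2⟩
    rcases abs_choice (k : ℝ) with h | h <;> rw [hKr] at h
    · rw [← h] at h1 h2
      have : 0 ≤ (2 * (K : ℝ) - 1) * δ := by
        apply mul_nonneg _ hδ0.le
        linarith
      rw [abs_of_nonneg (by linarith)]
      exact ⟨h1.le, h2⟩
    · have hk : (k : ℝ) = -K := by linarith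
      rw [hk] at h1 h2
      have : 0 ≤ (2 * (K : ℝ) - 1) * δ := by
        apply mul_nonneg _ hδ0.le
        linarith
      rw [abs_of_nonpos (by linarith)]
      constructor <;> linarith
  have hF : ∀ θ ∈ Ioc ((2 * (k : ℝ) - 1) * δ) ((2 * (k : ℝ) + 1) * δ),
      Fm m θ ^ ℓ * W θ ≤ ((2 / (3 * (K : ℝ))) ^ 2) ^ ℓ * W θ := by
    intro θ hθ
    obtain ⟨h1, h2⟩ := hrange θ hθ
    have h3 : |θ| ≤ π := by
      refine h2.trans ?_
      rw [← hδm]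
      gcongr
    exact mul_le_mul_of_nonneg_right
      (pow_le_pow_left₀ (Fm_nonneg m θ) (Fm_le hK hKm h1 h3) ℓ) (hW0 θ)
  have hstep : (∫ θ in ((2 * (k : ℝ) - 1) * δ)..((2 * (k : ℝ) + 1) * δ), Fm m θ ^ ℓ * W θ) ≤
      ((2 / (3 * (K : ℝ))) ^ 2) ^ ℓ *
        ∫ θ in ((2 * (k : ℝ) - 1) * δ)..((2 * (k : ℝ) + 1) * δ), W θ := by
    rw [← intervalIntegral.integral_const_mul, intervalIntegral.integral_of_le hab,
      intervalIntegral.integral_of_le hab]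
    refine integral_mono_of_nonneg
      (Filter.Eventually.of_forall fun θ => mul_nonneg (pow_nonneg (Fm_nonneg m θ) ℓ) (hW0 θ))
      ((hW.intervalIntegrable _ _).1.const_mul _) ?_
    exact (ae_restrict_mem measurableSet_Ioc).mono hF
  obtain ⟨j, hj1, hj2⟩ : ∃ j : ℕ, 2 * K + 1 ≤ 2 ^ j ∧ 2 ^ j ≤ 4 * K := by
    refine ⟨Nat.log 2 (2 * K) + 1, Nat.lt_pow_succ_log_self (by norm_num) _, ?_⟩
    have := Nat.pow_log_le_self 2 (x := 2 * K) (by omega)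
    rw [pow_succ]
    omega
  have hj1' : (2 * (K : ℝ) + 1) * δ ≤ 2 ^ j * δ := by
    gcongr
    exact_mod_cast hj1
  have hkK := abs_le.1 hKr.le
  have hsub : (∫ θ in ((2 * (k : ℝ) - 1) * δ)..((2 * (k : ℝ) + 1) * δ), W θ) ≤
      ∫ θ in (-(2 ^ j * δ))..(2 ^ j * δ), W θ := by
    refine intervalIntegral.integral_mono_interval ?_ hab ?_
      (Filter.Eventually.of_forall hW0) (hW.intervalIntegrable _ _)
    · nlinarith
    · nlinarith
  have hI : 0 ≤ ∫ θ in (-δ)..δ, W θ :=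
    intervalIntegral.integral_nonneg (by linarith) fun θ _ => hW0 θ
  have hLj := pow_le_of_five_mul_logb_le hL0 hℓ hK hj2
  calc _ ≤ ((2 / (3 * (K : ℝ))) ^ 2) ^ ℓ *
        ∫ θ in ((2 * (k : ℝ) - 1) * δ)..((2 * (k : ℝ) + 1) * δ), W θ := hstep
    _ ≤ ((2 / (3 * (K : ℝ))) ^ 2) ^ ℓ * ((3 * (K : ℝ) / 2) ^ ℓ * ∫ θ in (-δ)..δ, W θ) := by
        gcongr
        refine (hsub.trans (hd.integral_two_pow_mul_le hL0.le hδ0 j)).trans ?_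
        gcongr
    _ = (2 / (3 * (K : ℝ))) ^ ℓ * ∫ θ in (-δ)..δ, W θ := by
        rw [← mul_assoc, ← mul_pow]
        congr 2
        field_simp
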